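/- arXiv:2302.14176 — 5 statements merged into one kernel-verified Lean document; each statement's English description precedes it below -/
import Mathlib

section
/- Let r : ℕ → ℝ be a sequence with |r_k| ≤ B for all k ≥ 1, and let λ, γ ∈ (0,1). Then the series ∑_{n=1}^∞ λ^{n-1} · (∑_{k=1}^n r_k γ^{n-k}) converges and its sum equals (1/(1-λγ)) · ∑_{n=1}^∞ λ^{n-1} r_n. (This is the pathwise core of the paper's Optimality Equation theorem: the λ-discounted sum of γ-depreciated cumulative assets equals the ordinary λ-discounted sum of rewards scaled by 1/(1-λγ).) -/
/-- For a bounded reward sequence `r` (indexed from 1) and discount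
factors `l, g ∈ (0,1)`, the series `∑_{n=1}^∞ l^(n-1) · (∑_{k=1}^n r k · g^(n-k))`
converges with sum `(1/(1-l·g)) · ∑_{n=1}^∞ l^(n-1) · r n`. -/
theorem discounted_depreciating_eq_scaled_discounted
    (r : ℕ → ℝ) (B : ℝ) (hB : ∀ k, 1 ≤ k → |r k| ≤ B)
    (l g : ℝ) (hl : l ∈ Set.Ioo (0 : ℝ) 1) (hg : g ∈ Set.Ioo (0 : ℝ) 1) :
    HasSum (fun n : ℕ => l ^ n * ∑ k ∈ Finset.Icc 1 (n + 1), r k * g ^ (n + 1 - k))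
      ((1 / (1 - l * g)) * ∑' n : ℕ, l ^ n * r (n + 1)) := by
  obtain ⟨hl0, hl1⟩ := hl
  obtain ⟨hg0, hg1⟩ := hg
  have hlg0 : 0 ≤ l * g := by positivity
  have hlg1 : l * g < 1 := by nlinarith
  have hf : Summable (fun n : ℕ => ‖l ^ n * r (n + 1)‖) := by
    refine Summable.of_nonneg_of_le (fun n => norm_nonneg _) (fun n => ?_)
      ((summable_geometric_of_lt_one hl0.le hl1).mul_right B)
    rw [Real.norm_eq_abs, abs_mul, abs_of_pos (pow_pos hl0 n)]
    exact mul_le_mul_of_nonneg_left (hB (n + 1) (by omega)) (pow_pos hl0 n).le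
  have hh : Summable (fun n : ℕ => ‖(l * g) ^ n‖) := by
    refine (summable_geometric_of_lt_one hlg0 hlg1).congr (fun n => ?_)
    rw [Real.norm_eq_abs, abs_of_nonneg (pow_nonneg hlg0 n)]
  have key := hasSum_sum_range_mul_of_summable_norm hf hh
  rw [tsum_geometric_of_lt_one hlg0 hlg1, mul_comm (∑' n : ℕ, l ^ n * r (n + 1)), ← one_div] at key
  suffices hs : (fun n : ℕ => l ^ n * ∑ k ∈ Finset.Icc 1 (n + 1), r k * g ^ (n + 1 - k)) =
      fun n : ℕ => ∑ k ∈ Finset.range (n + 1), l ^ k * r (k + 1) * (l * g) ^ (n - k) by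
    rw [hs]
    exact key
  funext n
  have e : Finset.Icc 1 (n + 1) = Finset.Ico (0 + 1) (n + 1 + 1) := by
    ext x
    simp only [Finset.mem_Icc, Finset.mem_Ico]
    omega
  rw [e, ← Finset.sum_Ico_add', ← Finset.range_eq_Ico, Finset.mul_sum]
  refine Finset.sum_congr rfl (fun k hk => ?_)
  have hk' : k ≤ n := by
    have := Finset.mem_range.mp hk
    omega
  rw [show n + 1 - (k + 1) = n - k by omega, mul_pow]
  have : l ^ n = l ^ k * l ^ (n - k) := by
    rw [← pow_add, Nat.add_sub_cancel' hk']
  rw [this]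
  ring
end

section
/- Let r : ℕ → ℝ be a sequence with |r_k| ≤ B for all k ≥ 1, and let γ ∈ (0,1). Then lim_{n→∞} [ (1/n) ∑_{k=1}^n ∑_{i=1}^k r_i γ^{k-i} − (1/(1-γ)) · (1/n) ∑_{k=1}^n r_k ] = 0, i.e. the time-average of the cumulative depreciated asset values differs from 1/(1-γ) times the ordinary reward average by a quantity tending to zero. -/
open Filter

theorem dep_rec (r : ℕ → ℝ) (g : ℝ) (n : ℕ) :
    ∑ i ∈ Finset.Icc 1 (n+1), r i * g ^ (n + 1 - i)
      = g * ∑ i ∈ Finset.Icc 1 n, r i * g ^ (n - i) + r (n+1) := by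
  rw [Finset.sum_Icc_succ_top (by omega), Finset.mul_sum]
  congr 1
  · refine Finset.sum_congr rfl fun i hi => ?_
    have h := (Finset.mem_Icc.mp hi).2
    rw [Nat.succ_sub h, pow_succ]
    ring
  · simp

theorem dep_sum (r : ℕ → ℝ) (g : ℝ) (n : ℕ) :
    (1 - g) * ∑ k ∈ Finset.Icc 1 n, ∑ i ∈ Finset.Icc 1 k, r i * g ^ (k - i)
      = ∑ k ∈ Finset.Icc 1 n, r k - g * ∑ i ∈ Finset.Icc 1 n, r i * g ^ (n - i) := by
  induction n with
  | zero => simp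
  | succ n ih =>
    rw [Finset.sum_Icc_succ_top (by omega), Finset.sum_Icc_succ_top (f := r) (by omega),
      mul_add, ih, dep_rec]
    ring

theorem dep_bound (r : ℕ → ℝ) (B : ℝ) (hB : ∀ k, 1 ≤ k → |r k| ≤ B)
    (g : ℝ) (hg : g ∈ Set.Ioo (0 : ℝ) 1) (n : ℕ) :
    |∑ i ∈ Finset.Icc 1 n, r i * g ^ (n - i)| ≤ B / (1 - g) := by
  have h0 : 0 < 1 - g := by linarith [hg.2]
  have hB0 : 0 ≤ B := (abs_nonneg _).trans (hB 1 le_rfl)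
  induction n with
  | zero => simpa using div_nonneg hB0 h0.le
  | succ n ih =>
    rw [dep_rec]
    calc _ ≤ |g * ∑ i ∈ Finset.Icc 1 n, r i * g ^ (n - i)| + |r (n+1)| := abs_add_le _ _
      _ ≤ g * (B / (1 - g)) + B := by
        rw [abs_mul, abs_of_pos hg.1]
        exact add_le_add (mul_le_mul_of_nonneg_left ih hg.1.le) (hB _ (by omega))
      _ = B / (1 - g) := by field_simp; ring

/-- for a bounded reward sequence `r` (indexed from 1) and
`g ∈ (0,1)`, the time-average of the cumulative depreciated asset values differs
from `1/(1-g)` times the ordinary reward average by a quantity tending to zero. -/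
theorem average_depreciating_sub_scaled_average_tendsto_zero
    (r : ℕ → ℝ) (B : ℝ) (hB : ∀ k, 1 ≤ k → |r k| ≤ B)
    (g : ℝ) (hg : g ∈ Set.Ioo (0 : ℝ) 1) :
    Tendsto (fun n : ℕ =>
        (1 / (n : ℝ)) * ∑ k ∈ Finset.Icc 1 n, ∑ i ∈ Finset.Icc 1 k, r i * g ^ (k - i)
          - (1 / (1 - g)) * ((1 / (n : ℝ)) * ∑ k ∈ Finset.Icc 1 n, r k))
      atTop (nhds 0) := by
  have h0 : 0 < 1 - g := by linarith [hg.2]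
  have h1 : Tendsto (fun n : ℕ => (g / (1 - g) * (B / (1 - g))) * (1 / (n : ℝ)))
      atTop (nhds 0) := by
    simpa using (tendsto_one_div_atTop_nhds_zero_nat (𝕜 := ℝ)).const_mul
      (g / (1 - g) * (B / (1 - g)))
  refine squeeze_zero_norm (fun n => ?_) h1
  have hs := dep_sum r g n
  have hb := dep_bound r B hB g hg n
  set S := ∑ k ∈ Finset.Icc 1 n, ∑ i ∈ Finset.Icc 1 k, r i * g ^ (k - i)
  set A := ∑ i ∈ Finset.Icc 1 n, r i * g ^ (n - i)
  set R := ∑ k ∈ Finset.Icc 1 n, r k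
  have hS : S = (R - g * A) / (1 - g) := by
    rw [eq_div_iff h0.ne', ← hs]; ring
  have he : 1 / (n : ℝ) * S - 1 / (1 - g) * (1 / (n : ℝ) * R)
      = -(g / (1 - g) * A * (1 / (n : ℝ))) := by
    rw [hS]; ring
  have hg0 : 0 ≤ g / (1 - g) := div_nonneg hg.1.le h0.le
  have hn : (0 : ℝ) ≤ 1 / (n : ℝ) := by positivity
  rw [he, norm_neg, Real.norm_eq_abs, abs_mul, abs_mul, abs_of_nonneg hg0, abs_of_nonneg hn]
  exact mul_le_mul_of_nonneg_right (mul_le_mul_of_nonneg_left hb hg0) hn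
end

section
/- Let r : ℕ → ℝ be a sequence with |r_k| ≤ B for all k ≥ 1, let γ ∈ (0,1), and suppose that (1-λ) · ∑_{n=1}^∞ λ^{n-1} r_n tends to a limit L as λ → 1 from below. Then (1-λ) · ∑_{n=1}^∞ λ^{n-1} (∑_{k=1}^n r_k γ^{n-k}) tends to L/(1-γ) as λ → 1 from below. (Pathwise form of the paper's equation lim_{λ→1} (1-λ) V_λ^γ = V/(1-γ).) -/
open Filter

/-- for a bounded reward sequence `r` (indexed from 1) and
`g ∈ (0,1)`, if `(1-l) · ∑_{n=1}^∞ l^(n-1) r n → L` as `l → 1⁻`, then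
`(1-l) · ∑_{n=1}^∞ l^(n-1) (∑_{k=1}^n r k · g^(n-k)) → L/(1-g)` as `l → 1⁻`. -/
theorem abel_limit_discounted_depreciating
    (r : ℕ → ℝ) (B : ℝ) (hB : ∀ k, 1 ≤ k → |r k| ≤ B)
    (g : ℝ) (hg : g ∈ Set.Ioo (0 : ℝ) 1) (L : ℝ)
    (hL : Tendsto (fun l : ℝ => (1 - l) * ∑' n : ℕ, l ^ n * r (n + 1))
      (nhdsWithin 1 (Set.Ioo (0 : ℝ) 1)) (nhds L)) :
    Tendsto (fun l : ℝ =>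
        (1 - l) * ∑' n : ℕ, l ^ n * ∑ k ∈ Finset.Icc 1 (n + 1), r k * g ^ (n + 1 - k))
      (nhdsWithin 1 (Set.Ioo (0 : ℝ) 1)) (nhds (L / (1 - g))) := by
  obtain ⟨hg0, hg1⟩ := hg
  have hlim : Tendsto (fun l : ℝ => (1 - l * g)⁻¹) (nhdsWithin 1 (Set.Ioo (0 : ℝ) 1))
      (nhds (1 - g)⁻¹) := by
    have hc : ContinuousAt (fun l : ℝ => (1 - l * g)⁻¹) 1 := by
      apply ContinuousAt.inv₀
      · fun_prop
      · rw [one_mul]; linarith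
    have h := hc.tendsto
    rw [one_mul] at h
    exact h.mono_left nhdsWithin_le_nhds
  have hmul := hL.mul hlim
  rw [← div_eq_mul_inv] at hmul
  refine hmul.congr' ?_
  filter_upwards [self_mem_nhdsWithin] with l hl
  obtain ⟨hl0, hl1⟩ := hl
  have hlg0 : 0 ≤ l * g := by positivity
  have hlg1 : l * g < 1 := by nlinarith
  have hs1 : Summable fun n : ℕ => ‖l ^ n * r (n + 1)‖ := by
    refine Summable.of_nonneg_of_le (fun _ => norm_nonneg _) (fun n => ?_)
      ((summable_geometric_of_lt_one hl0.le hl1).mul_right B)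
    rw [norm_mul, Real.norm_eq_abs, Real.norm_eq_abs, abs_of_nonneg (pow_nonneg hl0.le n)]
    exact mul_le_mul_of_nonneg_left (hB _ (by omega)) (pow_nonneg hl0.le n)
  have hs2 : Summable fun n : ℕ => ‖(l * g) ^ n‖ :=
    (summable_geometric_of_lt_one hlg0 hlg1).norm
  have key := tsum_mul_tsum_eq_tsum_sum_range_of_summable_norm hs1 hs2
  rw [tsum_geometric_of_lt_one hlg0 hlg1] at key
  rw [mul_assoc, key]
  congr 1
  refine tsum_congr fun n => ?_
  rw [Finset.mul_sum, ← Finset.Ico_add_one_right_eq_Icc, Finset.sum_Ico_eq_sum_range]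
  refine Finset.sum_congr (by simp) fun k hk => ?_
  have hk' : k ≤ n := by simp at hk; omega
  obtain ⟨m, rfl⟩ := Nat.exists_eq_add_of_le hk'
  have e1 : k + m - k = m := by omega
  have e2 : k + m + 1 - (1 + k) = m := by omega
  rw [e1, e2, add_comm 1 k, mul_pow, pow_add]
  ring
end

section
/- Let r : ℕ → ℝ be a sequence with |r_k| ≤ B for all k ≥ 1, and let λ ∈ (0,1) be fixed. Then ∑_{n=1}^∞ λ^{n-1} (∑_{k=1}^n r_k γ^{n-k}) tends to (1/(1-λ)) · ∑_{n=1}^∞ λ^{n-1} r_n as γ → 1 from below. (Pathwise form of the paper's equation lim_{γ→1} V_λ^γ = V_λ/(1-λ).) -/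
open Filter

/-- for a bounded reward sequence `r` (indexed from 1) and fixed
`l ∈ (0,1)`, the discounted depreciating payoff tends to
`(1/(1-l)) · ∑_{n=1}^∞ l^(n-1) r n` as `g → 1⁻`. -/
theorem discounted_depreciating_tendsto_as_gamma_to_one
    (r : ℕ → ℝ) (B : ℝ) (hB : ∀ k, 1 ≤ k → |r k| ≤ B)
    (l : ℝ) (hl : l ∈ Set.Ioo (0 : ℝ) 1) :
    Tendsto (fun g : ℝ =>
        ∑' n : ℕ, l ^ n * ∑ k ∈ Finset.Icc 1 (n + 1), r k * g ^ (n + 1 - k))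
      (nhdsWithin 1 (Set.Ioo (0 : ℝ) 1))
      (nhds ((1 / (1 - l)) * ∑' n : ℕ, l ^ n * r (n + 1))) := by
  obtain ⟨h0, h1⟩ := hl
  have hf : Summable (fun n : ℕ => ‖l ^ n * r (n + 1)‖) := by
    refine Summable.of_nonneg_of_le (fun _ => norm_nonneg _) (fun n => ?_)
      ((summable_geometric_of_lt_one h0.le h1).mul_right B)
    rw [norm_mul, norm_pow, Real.norm_of_nonneg h0.le, Real.norm_eq_abs]
    exact mul_le_mul_of_nonneg_left (hB _ (by omega)) (by positivity)
  have key : ∀ g ∈ Set.Ioo (0 : ℝ) 1,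
      (1 / (1 - l * g)) * ∑' n : ℕ, l ^ n * r (n + 1) =
      ∑' n : ℕ, l ^ n * ∑ k ∈ Finset.Icc 1 (n + 1), r k * g ^ (n + 1 - k) := by
    rintro g ⟨hg0, hg1⟩
    have hp : 0 ≤ l * g := by positivity
    have hlt : l * g < 1 := by nlinarith
    have hG : Summable (fun n : ℕ => ‖(l * g) ^ n‖) :=
      (summable_geometric_of_lt_one hp hlt).norm
    rw [one_div, ← tsum_geometric_of_lt_one hp hlt, mul_comm,
      tsum_mul_tsum_eq_tsum_sum_range_of_summable_norm hf hG]
    refine tsum_congr fun n => ?_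
    rw [Finset.mul_sum, ← Finset.Ico_add_one_right_eq_Icc, Finset.sum_Ico_eq_sum_range]
    refine Finset.sum_congr (by simp) fun k hk => ?_
    have hk' : k ≤ n := by
      have := Finset.mem_range.1 hk
      omega
    rw [show n + 1 - (1 + k) = n - k by omega, mul_pow, add_comm 1 k,
      show l ^ n = l ^ k * l ^ (n - k) by rw [← pow_add]; congr 1; omega]
    ring
  have ht : Tendsto (fun g : ℝ => (1 / (1 - l * g)) * ∑' n : ℕ, l ^ n * r (n + 1))
      (nhdsWithin 1 (Set.Ioo (0 : ℝ) 1))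
      (nhds ((1 / (1 - l)) * ∑' n : ℕ, l ^ n * r (n + 1))) := by
    have hc : ContinuousAt
        (fun g : ℝ => (1 / (1 - l * g)) * ∑' n : ℕ, l ^ n * r (n + 1)) 1 := by
      refine ContinuousAt.mul (ContinuousAt.div (by fun_prop) (by fun_prop) ?_) (by fun_prop)
      rw [mul_one]
      linarith
    have := hc.tendsto
    simp only [mul_one] at this
    exact this.mono_left nhdsWithin_le_nhds
  refine ht.congr' ?_
  filter_upwards [self_mem_nhdsWithin] with g hg using key g hg
end

section
/- Let r : ℕ → ℝ be a sequence with |r_k| ≤ B for all k ≥ 1, and let λ ∈ (0,1) be fixed. Then ∑_{n=1}^∞ λ^{n-1} (∑_{k=1}^n r_k γ^{n-k}) tends to ∑_{n=1}^∞ λ^{n-1} r_n as γ → 0 from above. (Pathwise form of the paper's equation lim_{γ→0} V_λ^γ = V_λ: with no memory of past assets, the discounted depreciating payoff reduces to the ordinary discounted payoff.) -/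
open Filter

/-- for a bounded reward sequence `r` (indexed from 1) and fixed
`l ∈ (0,1)`, the discounted depreciating payoff tends to the ordinary discounted
payoff `∑_{n=1}^∞ l^(n-1) r n` as `g → 0⁺`. -/
theorem discounted_depreciating_tendsto_as_gamma_to_zero
    (r : ℕ → ℝ) (B : ℝ) (hB : ∀ k, 1 ≤ k → |r k| ≤ B)
    (l : ℝ) (hl : l ∈ Set.Ioo (0 : ℝ) 1) :
    Tendsto (fun g : ℝ =>
        ∑' n : ℕ, l ^ n * ∑ k ∈ Finset.Icc 1 (n + 1), r k * g ^ (n + 1 - k))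
      (nhdsWithin 0 (Set.Ioo (0 : ℝ) 1))
      (nhds (∑' n : ℕ, l ^ n * r (n + 1))) := by
  obtain ⟨h0, h1⟩ := hl
  have hB0 : 0 ≤ B := (abs_nonneg _).trans (hB 1 le_rfl)
  refine tendsto_tsum_of_dominated_convergence
    (bound := fun n : ℕ => l ^ n * (((n : ℝ) + 1) * B)) ?_ ?_ ?_
  · have hs1 : Summable (fun n : ℕ => (n : ℝ) ^ 1 * l ^ n) :=
      summable_pow_mul_geometric_of_norm_lt_one 1
        (by rw [Real.norm_eq_abs, abs_of_pos h0]; exact h1)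
    have hs2 : Summable (fun n : ℕ => l ^ n) := summable_geometric_of_lt_one h0.le h1
    refine ((hs1.add hs2).mul_right B).congr ?_
    intro n
    ring
  · intro n
    have hc : Continuous (fun g : ℝ =>
        l ^ n * ∑ k ∈ Finset.Icc 1 (n + 1), r k * g ^ (n + 1 - k)) := by fun_prop
    have hv : l ^ n * ∑ k ∈ Finset.Icc 1 (n + 1), r k * (0 : ℝ) ^ (n + 1 - k)
        = l ^ n * r (n + 1) := by
      congr 1
      rw [Finset.sum_eq_single (n + 1)]
      · simp
      · intro k hk hne
        have hk2 := (Finset.mem_Icc.mp hk).2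
        rw [zero_pow (by omega), mul_zero]
      · intro h
        exact absurd (Finset.mem_Icc.mpr ⟨by omega, le_rfl⟩) h
    have ht := (hc.tendsto 0).mono_left (nhdsWithin_le_nhds (s := Set.Ioo (0 : ℝ) 1))
    rw [← hv]
    exact ht
  · filter_upwards [self_mem_nhdsWithin] with g hg n
    rw [Real.norm_eq_abs, abs_mul, abs_of_pos (pow_pos h0 n)]
    refine mul_le_mul_of_nonneg_left ?_ (pow_pos h0 n).le
    refine (Finset.abs_sum_le_sum_abs _ _).trans ?_
    have hle : ∀ k ∈ Finset.Icc 1 (n + 1), |r k * g ^ (n + 1 - k)| ≤ B := by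
      intro k hk
      rw [abs_mul, abs_of_nonneg (pow_nonneg hg.1.le _)]
      calc |r k| * g ^ (n + 1 - k) ≤ B * 1 :=
            mul_le_mul (hB k (Finset.mem_Icc.mp hk).1) (pow_le_one₀ hg.1.le hg.2.le)
              (pow_nonneg hg.1.le _) hB0
        _ = B := mul_one B
    refine (Finset.sum_le_card_nsmul _ _ B hle).trans ?_
    simp
end
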